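/- Let f : ℝ³ → ℝ be smooth, compactly supported in {x₁² + x₂² < 1}, and periodic in x₃ with period Z₀ > 0. Then there exists a constant C (depending only on Z₀) such that (∫_{D₁} |f|³ dx)^{1/3} ≤ C (∫_{D₁} |∇f|² dx)^{1/2}, where D₁ = {x₁² + x₂² < 1, 0 ≤ x₃ < Z₀}. -/

import Mathlib

open MeasureTheory Set

lemma cutoff_exists (Z : ℝ) (hZ : 0 < Z) :
    ∃ (g : ℝ → ℝ) (M : ℝ), ContDiff ℝ (⊤ : ℕ∞) g ∧ (∀ t, 0 ≤ g t) ∧ (∀ t, g t ≤ 1) ∧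
      (∀ t ∈ Icc 0 Z, g t = 1) ∧ (∀ t, t ∉ Ico (-Z) (2 * Z) → g t = 0) ∧
      (∀ t, t ∉ Ico (-Z) (2 * Z) → deriv g t = 0) ∧ (∀ t, |deriv g t| ≤ M) := by
  let b : ContDiffBump (Z / 2 : ℝ) := ⟨Z / 2, Z, by linarith, by linarith⟩
  have hts : ∀ t, t ∉ Ico (-Z) (2 * Z) → t ∉ tsupport b := by
    intro t ht h
    apply ht
    rw [b.tsupport_eq, Metric.mem_closedBall, Real.dist_eq, abs_le] at h
    have h1 : b.rOut = Z := rfl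
    rw [h1] at h
    constructor <;> linarith [h.1, h.2]
  have hb : ContDiff ℝ (⊤ : ℕ∞) b := b.contDiff
  have hd : Continuous (deriv b) := hb.continuous_deriv (by exact_mod_cast le_top)
  obtain ⟨M, hM⟩ := hd.bounded_above_of_compact_support b.hasCompactSupport.deriv
  refine ⟨b, M, hb, fun t => b.nonneg, fun t => b.le_one, ?_, ?_, ?_, ?_⟩
  · intro t ht
    apply b.one_of_mem_closedBall
    rw [Metric.mem_closedBall, Real.dist_eq, abs_le]
    change -(Z/2) ≤ _ ∧ _ ≤ Z / 2
    constructor <;> linarith [ht.1, ht.2]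
  · intro t ht
    exact image_eq_zero_of_notMem_tsupport (hts t ht)
  · intro t ht
    exact image_eq_zero_of_notMem_tsupport (fun h => hts t ht (tsupport_deriv_subset h))
  · exact hM

lemma cpt_supp {F : Type*} [Zero F] (R : ℝ) (φ : EuclideanSpace ℝ (Fin 3) → F)
    (h1 : ∀ x : EuclideanSpace ℝ (Fin 3), 1 ≤ x 0 ^ 2 + x 1 ^ 2 → φ x = 0)
    (h2 : ∀ x : EuclideanSpace ℝ (Fin 3), R < |x 2| → φ x = 0) : HasCompactSupport φ := by
  apply HasCompactSupport.intro (isCompact_closedBall (0 : EuclideanSpace ℝ (Fin 3)) (1 + |R|))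
  intro x hx
  by_contra hne
  apply hx
  have a1 : x 0 ^ 2 + x 1 ^ 2 < 1 := by
    by_contra h; exact hne (h1 x (not_lt.mp h))
  have a2 : |x 2| ≤ R := by
    by_contra h; exact hne (h2 x (not_le.mp h))
  rw [mem_closedBall_zero_iff]
  apply abs_le_of_sq_le_sq' _ (by positivity) |>.2
  rw [EuclideanSpace.norm_sq_eq, Fin.sum_univ_three]
  simp only [Real.norm_eq_abs, sq_abs]
  have a3 : x 2 ^ 2 ≤ |R| ^ 2 := by
    rw [sq_abs R, sq_le_sq]
    exact a2.trans (le_abs_self R)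
  nlinarith [abs_nonneg R]

lemma fderiv_zero_out (f : EuclideanSpace ℝ (Fin 3) → ℝ) (hf : ContDiff ℝ (⊤ : ℕ∞) f)
    (h0 : ∀ x : EuclideanSpace ℝ (Fin 3), 1 ≤ x 0 ^ 2 + x 1 ^ 2 → f x = 0) (x : EuclideanSpace ℝ (Fin 3)) (hx : 1 ≤ x 0 ^ 2 + x 1 ^ 2) :
    fderiv ℝ f x = 0 := by
  have hc : Continuous (fderiv ℝ f) := hf.continuous_fderiv (by simp)
  have hstrict : ∀ y : EuclideanSpace ℝ (Fin 3), 1 < y 0 ^ 2 + y 1 ^ 2 → fderiv ℝ f y = 0 := by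
    intro y hy
    have : f =ᶠ[nhds y] fun _ => 0 := by
      have ho : IsOpen {y : EuclideanSpace ℝ (Fin 3) | 1 < y 0 ^ 2 + y 1 ^ 2} :=
        isOpen_lt (by fun_prop) (by fun_prop)
      filter_upwards [ho.mem_nhds hy] with z hz
      exact h0 z (le_of_lt hz)
    rw [this.fderiv_eq]
    simp
  have ht : Filter.Tendsto (fun t : ℝ => fderiv ℝ f (t • x)) (nhdsWithin 1 (Ioi 1))
      (nhds (fderiv ℝ f ((1:ℝ) • x))) := by
    have : Continuous (fun t : ℝ => fderiv ℝ f (t • x)) := by fun_prop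
    exact (this.tendsto 1).mono_left nhdsWithin_le_nhds
  rw [one_smul] at ht
  refine tendsto_nhds_unique ht ?_
  refine tendsto_const_nhds.congr' ?_
  filter_upwards [self_mem_nhdsWithin] with t ht
  symm
  apply hstrict
  simp only [PiLp.smul_apply, smul_eq_mul]
  have : 1 < t := ht
  nlinarith [mul_pos (sub_pos.2 this) (sub_pos.2 this)]

lemma integral_fderiv_zero (P : EuclideanSpace ℝ (Fin 3) → ℝ) (hP : ContDiff ℝ 1 P) (hc : HasCompactSupport P) (v : EuclideanSpace ℝ (Fin 3)) :
    ∫ x, fderiv ℝ P x v = 0 := by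
  have hd : Continuous (fun x => fderiv ℝ P x v) :=
    (hP.continuous_fderiv (by simp)).clm_apply continuous_const
  have := integral_mul_fderiv_eq_neg_fderiv_mul_of_integrable (μ := (volume : Measure (EuclideanSpace ℝ (Fin 3))))
    (f := fun _ : EuclideanSpace ℝ (Fin 3) => (1:ℝ)) (g := P) (v := v) (by simp)
    (by simpa using hd.integrable_of_hasCompactSupport (hc.fderiv_apply (𝕜 := ℝ) v))
    (by simpa using hP.continuous.integrable_of_hasCompactSupport hc)
    (by intros; fun_prop) (fun x _ => hP.differentiable (by simp) x)
  simpa using this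

lemma poincare (R : ℝ) (w : ℝ → ℝ) (hw : ContDiff ℝ 1 w) (hw0 : ∀ t, 0 ≤ w t)
    (hws : ∀ t, R < |t| → w t = 0) (f : EuclideanSpace ℝ (Fin 3) → ℝ) (hf : ContDiff ℝ (⊤ : ℕ∞) f)
    (h0 : ∀ x : EuclideanSpace ℝ (Fin 3), 1 ≤ x 0 ^ 2 + x 1 ^ 2 → f x = 0) :
    ∫ x : EuclideanSpace ℝ (Fin 3), w (x 2) * f x ^ 2 ≤ 4 * ∫ x : EuclideanSpace ℝ (Fin 3), w (x 2) * ‖fderiv ℝ f x‖ ^ 2 := by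
  have hf1 : ContDiff ℝ 1 f := hf.of_le (by exact_mod_cast le_top)
  have hdf : Continuous (fderiv ℝ f) := hf.continuous_fderiv (by simp)
  have hwc := hw.continuous
  have hfc := hf.continuous
  have hp0 : ContDiff ℝ 1 (fun x : EuclideanSpace ℝ (Fin 3) => x 0) := by fun_prop
  have hp2 : ContDiff ℝ 1 (fun x : EuclideanSpace ℝ (Fin 3) => w (x 2)) := by
    exact hw.comp (by fun_prop : ContDiff ℝ 1 (fun x : EuclideanSpace ℝ (Fin 3) => x 2))
  have hz := fderiv_zero_out f hf h0
  set P : EuclideanSpace ℝ (Fin 3) → ℝ := fun x => x 0 * (w (x 2) * f x ^ 2) with hPdef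
  have hP : ContDiff ℝ 1 P := hp0.mul (hp2.mul (hf1.pow 2))
  have hPc : HasCompactSupport P := by
    apply cpt_supp R
    · intro x hx; simp [P, h0 x hx]
    · intro x hx; simp [P, hws _ hx]
  set v : EuclideanSpace ℝ (Fin 3) := EuclideanSpace.single 0 1 with hv
  have hvn : ‖v‖ = 1 := by simp [hv]
  have hder : ∀ x, fderiv ℝ P x v =
      w (x 2) * f x ^ 2 + x 0 * (w (x 2) * (2 * f x * fderiv ℝ f x v)) := by
    intro x
    have a0 : HasFDerivAt (fun x : EuclideanSpace ℝ (Fin 3) => x 0) (EuclideanSpace.proj (𝕜 := ℝ) 0 : EuclideanSpace ℝ (Fin 3) →L[ℝ] ℝ) x :=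
      (EuclideanSpace.proj (𝕜 := ℝ) 0 : EuclideanSpace ℝ (Fin 3) →L[ℝ] ℝ).hasFDerivAt
    have a2 : HasFDerivAt (fun x : EuclideanSpace ℝ (Fin 3) => x 2) (EuclideanSpace.proj (𝕜 := ℝ) 2 : EuclideanSpace ℝ (Fin 3) →L[ℝ] ℝ) x :=
      (EuclideanSpace.proj (𝕜 := ℝ) 2 : EuclideanSpace ℝ (Fin 3) →L[ℝ] ℝ).hasFDerivAt
    have aw : HasDerivAt w (deriv w (x 2)) (x 2) :=
      (hw.differentiable (by simp) _).hasDerivAt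
    have af : HasFDerivAt f (fderiv ℝ f x) x := (hf1.differentiable (by simp) x).hasFDerivAt
    have := a0.mul ((aw.comp_hasFDerivAt x a2).mul (af.pow 2))
    have h := this.fderiv
    have h' : fderiv ℝ P x = _ := h
    rw [h']
    simp [hv]
    ring
  have hint := integral_fderiv_zero P hP hPc v
  have i1 : Integrable (fun x : EuclideanSpace ℝ (Fin 3) => w (x 2) * f x ^ 2) := by
    refine Continuous.integrable_of_hasCompactSupport (by fun_prop) (cpt_supp R _ ?_ ?_)
    · intro x hx; simp [h0 x hx]
    · intro x hx; simp [hws _ hx]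
  have i2 : Integrable (fun x : EuclideanSpace ℝ (Fin 3) => w (x 2) * ‖fderiv ℝ f x‖ ^ 2) := by
    refine Continuous.integrable_of_hasCompactSupport (by fun_prop) (cpt_supp R _ ?_ ?_)
    · intro x hx; simp [hz x hx]
    · intro x hx; simp [hws _ hx]
  have i3 : Integrable (fun x : EuclideanSpace ℝ (Fin 3) => fderiv ℝ P x v) := by
    refine Continuous.integrable_of_hasCompactSupport ?_ (hPc.fderiv_apply (𝕜 := ℝ) v)
    exact (hP.continuous_fderiv (by simp)).clm_apply continuous_const
  have key : ∫ x : EuclideanSpace ℝ (Fin 3), ((1/2) * (w (x 2) * f x ^ 2) - 2 * (w (x 2) * ‖fderiv ℝ f x‖ ^ 2)) ≤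
      ∫ x : EuclideanSpace ℝ (Fin 3), fderiv ℝ P x v := by
    apply integral_mono ((i1.const_mul _).sub (i2.const_mul _)) i3
    intro x
    simp only [Pi.sub_apply]
    rw [hder x]
    by_cases hx : 1 ≤ x 0 ^ 2 + x 1 ^ 2
    · simp [h0 x hx, hz x hx]
    · have hx0 : x 0 ^ 2 ≤ 1 := by nlinarith [sq_nonneg (x 1)]
      have hd : |fderiv ℝ f x v| ≤ ‖fderiv ℝ f x‖ := by
        have := (fderiv ℝ f x).le_opNorm v
        rwa [hvn, mul_one] at this
      have hd2 : (fderiv ℝ f x v) ^ 2 ≤ ‖fderiv ℝ f x‖ ^ 2 := by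
        rw [← sq_abs]; gcongr
      have hww := hw0 (x 2)
      have e1 : (x 0 * fderiv ℝ f x v) ^ 2 ≤ ‖fderiv ℝ f x‖ ^ 2 := by
        rw [mul_pow]
        nlinarith [sq_nonneg (fderiv ℝ f x v)]
      have e2 : 0 ≤ f x ^ 2 + 2 * f x * (x 0 * fderiv ℝ f x v) - (1/2) * f x ^ 2
          + 2 * ‖fderiv ℝ f x‖ ^ 2 := by
        nlinarith [sq_nonneg (f x + 2 * (x 0 * fderiv ℝ f x v))]
      nlinarith [mul_nonneg hww e2]
  rw [hint, integral_sub (i1.const_mul _) (i2.const_mul _), integral_const_mul,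
    integral_const_mul] at key
  linarith

lemma lp_real {F : Type*} [NormedAddCommGroup F] (φ : EuclideanSpace ℝ (Fin 3) → F) (hφ : Continuous φ)
    (hc : HasCompactSupport φ) (n : ℕ) (hn : n ≠ 0) :
    eLpNorm φ (n : NNReal) volume = ENNReal.ofReal ((∫ x, ‖φ x‖ ^ n) ^ ((1:ℝ) / n)) := by
  rw [MemLp.eLpNorm_eq_integral_rpow_norm (by simpa using hn) (by simp)
    (hφ.memLp_of_hasCompactSupport hc)]
  simp

/-- Integrals over three periods are controlled by the integral over one period. -/
lemma three_periods (Z : ℝ) (hZ : 0 < Z) (H : EuclideanSpace ℝ (Fin 3) → ℝ) (hH : Continuous H) (hH0 : ∀ x, 0 ≤ H x)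
    (hper : ∀ x : EuclideanSpace ℝ (Fin 3), H (x + Z • EuclideanSpace.single 2 1) = H x)
    (hout : ∀ x : EuclideanSpace ℝ (Fin 3), 1 ≤ x 0 ^ 2 + x 1 ^ 2 → H x = 0)
    (a : ℝ → ℝ) (ha : Continuous a) (A : ℝ) (haA : ∀ t, a t ≤ A) (hA : 0 ≤ A)
    (has : ∀ t, t ∉ Ico (-Z) (2 * Z) → a t = 0) :
    ∫ x : EuclideanSpace ℝ (Fin 3), a (x 2) * H x ≤ A * (3 * ∫ x in {x : EuclideanSpace ℝ (Fin 3) |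
            x 0 ^ 2 + x 1 ^ 2 < 1 ∧ x 2 ∈ Ico (0:ℝ) Z}, H x) := by
  set D : Set (EuclideanSpace ℝ (Fin 3)) := {x : EuclideanSpace ℝ (Fin 3) | x 0 ^ 2 + x 1 ^ 2 < 1 ∧ x 2 ∈ Ico (0:ℝ) Z} with hD
  set e : EuclideanSpace ℝ (Fin 3) := Z • EuclideanSpace.single 2 1 with he
  have hDm : MeasurableSet D := by
    have h1 : MeasurableSet {x : EuclideanSpace ℝ (Fin 3) | x 0 ^ 2 + x 1 ^ 2 < 1} :=
      (isOpen_lt (by fun_prop) (by fun_prop)).measurableSet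
    have h2 : MeasurableSet ((fun x : EuclideanSpace ℝ (Fin 3) => x 2) ⁻¹' Ico (0:ℝ) Z) :=
      measurableSet_Ico.preimage (by fun_prop : Continuous fun x : EuclideanSpace ℝ (Fin 3) => x 2).measurable
    exact h1.inter h2
  have hint : Integrable (D.indicator H) := by
    rw [integrable_indicator_iff hDm]
    refine (hH.continuousOn.integrableOn_compact
      (isCompact_closedBall (0 : EuclideanSpace ℝ (Fin 3)) (1 + Z))).mono_set ?_
    intro x hx
    rw [mem_closedBall_zero_iff]
    apply abs_le_of_sq_le_sq' _ (by positivity) |>.2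
    rw [EuclideanSpace.norm_sq_eq, Fin.sum_univ_three]
    simp only [Real.norm_eq_abs, sq_abs]
    have h1 := hx.1
    have h2 := hx.2.1
    have h3 := hx.2.2
    nlinarith
  have hper' : ∀ x, H (x + -e) = H x := by
    intro x
    rw [← hper (x + -e)]
    simp
  have e0 : e 0 = 0 := by simp [he]
  have e1 : e 1 = 0 := by simp [he]
  have e2 : e 2 = Z := by simp [he]
  have ip := hint.comp_add_right e
  have im := hint.comp_add_right (-e)
  have hnn : ∀ x, 0 ≤ D.indicator H x := fun x => indicator_nonneg (fun x _ => hH0 x) x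
  have hbound : ∀ x : EuclideanSpace ℝ (Fin 3), a (x 2) * H x ≤
      A * (D.indicator H x + D.indicator H (x + e) + D.indicator H (x + -e)) := by
    intro x
    have n1 := hnn x
    have n2 := hnn (x + e)
    have n3 := hnn (x + -e)
    by_cases hx : 1 ≤ x 0 ^ 2 + x 1 ^ 2
    · rw [hout x hx, mul_zero]; positivity
    by_cases ht : x 2 ∈ Ico (-Z) (2 * Z)
    · have hle : a (x 2) * H x ≤ A * H x := mul_le_mul_of_nonneg_right (haA _) (hH0 x)
      refine hle.trans (mul_le_mul_of_nonneg_left ?_ hA)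
      have hx' := not_le.mp hx
      rcases lt_or_ge (x 2) 0 with h | h
      · have : x + e ∈ D := by
          refine ⟨by simpa [e0, e1] using hx', ?_, ?_⟩ <;>
            simp only [PiLp.add_apply, e2] <;> linarith [ht.1]
        have : D.indicator H (x + e) = H x := by rw [indicator_of_mem this, hper]
        linarith
      rcases lt_or_ge (x 2) Z with h' | h'
      · have : x ∈ D := ⟨hx', h, h'⟩
        have : D.indicator H x = H x := indicator_of_mem this _
        linarith
      · have : x + -e ∈ D := by
          refine ⟨by simpa [e0, e1] using hx', ?_, ?_⟩ <;>
            simp only [PiLp.add_apply, PiLp.neg_apply, e2] <;> linarith [ht.2]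
        have : D.indicator H (x + -e) = H x := by rw [indicator_of_mem this, hper']
        linarith
    · rw [has _ ht, zero_mul]; positivity
  have il : Integrable (fun x : EuclideanSpace ℝ (Fin 3) => a (x 2) * H x) := by
    refine Continuous.integrable_of_hasCompactSupport (by fun_prop) (cpt_supp (2 * Z) _ ?_ ?_)
    · intro x hx; simp [hout x hx]
    · intro x hx
      have : x 2 ∉ Ico (-Z) (2 * Z) := by
        intro h
        have : |x 2| ≤ 2 * Z := abs_le.mpr ⟨by linarith [h.1], h.2.le⟩
        linarith
      simp [has _ this]
  calc ∫ x : EuclideanSpace ℝ (Fin 3), a (x 2) * H x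
      ≤ ∫ x : EuclideanSpace ℝ (Fin 3), A * (D.indicator H x + D.indicator H (x + e) + D.indicator H (x + -e)) :=
        integral_mono il (((hint.add ip).add im).const_mul A) hbound
    _ = A * (3 * ∫ x in D, H x) := by
        rw [integral_const_mul, integral_add (f := fun x => D.indicator H x + D.indicator H (x + e))
          (hint.add ip) im, integral_add hint ip,
          integral_add_right_eq_self (D.indicator H) e,
          integral_add_right_eq_self (D.indicator H) (-e), integral_indicator hDm]
        ring

theorem stmt_15 (Z₀ : ℝ) (hZ₀ : 0 < Z₀) :
    ∃ C : ℝ, 0 < C ∧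
      ∀ f : EuclideanSpace ℝ (Fin 3) → ℝ,
        ContDiff ℝ (⊤ : ℕ∞) f →
        (∀ x : EuclideanSpace ℝ (Fin 3), 1 ≤ x 0 ^ 2 + x 1 ^ 2 → f x = 0) →
        (∀ x : EuclideanSpace ℝ (Fin 3), f (x + Z₀ • EuclideanSpace.single 2 1) = f x) →
        (∫ x in {x : EuclideanSpace ℝ (Fin 3) |
            x 0 ^ 2 + x 1 ^ 2 < 1 ∧ x 2 ∈ Ico (0:ℝ) Z₀}, |f x| ^ 3) ^ ((1:ℝ)/3) ≤
          C * (∫ x in {x : EuclideanSpace ℝ (Fin 3) |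
            x 0 ^ 2 + x 1 ^ 2 < 1 ∧ x 2 ∈ Ico (0:ℝ) Z₀}, ‖fderiv ℝ f x‖ ^ 2) ^ ((1:ℝ)/2) := by
  obtain ⟨g, M, hg, hg0, hg1, hgI, hgs, hgds, hgM⟩ := cutoff_exists Z₀ hZ₀
  set s : Set (EuclideanSpace ℝ (Fin 3)) := Metric.closedBall 0 (1 + 2 * Z₀) with hs
  set K : NNReal := eLpNormLESNormFDerivOfLeConst ℝ (volume : Measure (EuclideanSpace ℝ (Fin 3))) s 2 3 with hK
  have hM0 : 0 ≤ M := (abs_nonneg _).trans (hgM 0)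
  set B : ℝ := (2 + 8 * M ^ 2) * 3 with hB
  have hBpos : 0 < B := by positivity
  refine ⟨(K + 1) * B ^ ((1:ℝ)/2), by positivity, ?_⟩
  intro f hf h0 hper
  set D : Set (EuclideanSpace ℝ (Fin 3)) := {x : EuclideanSpace ℝ (Fin 3) | x 0 ^ 2 + x 1 ^ 2 < 1 ∧ x 2 ∈ Ico (0:ℝ) Z₀} with hD
  have hDm : MeasurableSet D := by
    have h1 : MeasurableSet {x : EuclideanSpace ℝ (Fin 3) | x 0 ^ 2 + x 1 ^ 2 < 1} :=
      (isOpen_lt (by fun_prop) (by fun_prop)).measurableSet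
    have h2 : MeasurableSet ((fun x : EuclideanSpace ℝ (Fin 3) => x 2) ⁻¹' Ico (0:ℝ) Z₀) :=
      measurableSet_Ico.preimage (by fun_prop : Continuous fun x : EuclideanSpace ℝ (Fin 3) => x 2).measurable
    exact h1.inter h2
  have hz := fderiv_zero_out f hf h0
  have hf1 : ContDiff ℝ 1 f := hf.of_le (by exact_mod_cast le_top)
  have hgc1 : ContDiff ℝ 1 g := hg.of_le (by exact_mod_cast le_top)
  have hdf : Continuous (fderiv ℝ f) := hf.continuous_fderiv (by simp)
  have hfc := hf.continuous
  have hgc := hg.continuous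
  have hdg1 : ContDiff ℝ 1 (deriv g) := by
    have : ContDiff ℝ (1 + 1) g := contDiff_infty.mp hg 2
    exact (contDiff_succ_iff_deriv.mp this).2.2
  have hdgc := hdg1.continuous
  have habs : ∀ t, 2 * Z₀ < |t| → t ∉ Ico (-Z₀) (2 * Z₀) := by
    intro t ht h
    have : |t| ≤ 2 * Z₀ := abs_le.mpr ⟨by linarith [h.1], h.2.le⟩
    linarith
  set u : EuclideanSpace ℝ (Fin 3) → ℝ := fun x => g (x 2) * f x with hu
  have hu1 : ContDiff ℝ 1 u :=
    (hgc1.comp (by fun_prop : ContDiff ℝ 1 (fun x : EuclideanSpace ℝ (Fin 3) => x 2))).mul hf1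
  have huc : HasCompactSupport u := by
    apply cpt_supp (2 * Z₀)
    · intro x hx; simp [u, h0 x hx]
    · intro x hx; simp [u, hgs _ (habs _ hx)]
  have hus : u.support ⊆ s := by
    intro x hx
    have a1 : x 0 ^ 2 + x 1 ^ 2 < 1 := by
      by_contra h; exact hx (by simp [u, h0 x (not_lt.mp h)])
    have a2 : |x 2| ≤ 2 * Z₀ := by
      by_contra h; exact hx (by simp [u, hgs _ (habs _ (not_le.mp h))])
    rw [hs, mem_closedBall_zero_iff]
    apply abs_le_of_sq_le_sq' _ (by positivity) |>.2
    rw [EuclideanSpace.norm_sq_eq, Fin.sum_univ_three]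
    simp only [Real.norm_eq_abs, sq_abs]
    have a3 : x 2 ^ 2 ≤ (2 * Z₀) ^ 2 := by
      rw [sq_le_sq, abs_of_pos (by positivity : 0 < 2 * Z₀)]
      exact a2
    nlinarith
  have hud : Continuous (fderiv ℝ u) := hu1.continuous_fderiv (by simp)
  have hudc : HasCompactSupport (fderiv ℝ u) := huc.fderiv (𝕜 := ℝ)
  -- the Sobolev inequality on the whole space
  have hsob := eLpNorm_le_eLpNorm_fderiv_of_le (volume : Measure (EuclideanSpace ℝ (Fin 3))) hu1 hus
    (p := 2) (q := 3) (by norm_num) (by simp; norm_num) (by simp; norm_num)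
    Metric.isBounded_closedBall
  have l3 := lp_real u hu1.continuous huc 3 (by norm_num)
  have l2 := lp_real (fderiv ℝ u) hud hudc 2 (by norm_num)
  have hsobR : (∫ x, ‖u x‖ ^ 3) ^ ((1:ℝ)/3) ≤ K * (∫ x, ‖fderiv ℝ u x‖ ^ 2) ^ ((1:ℝ)/2) := by
    push_cast at l3 l2 hsob
    rw [l3, l2, ← hK, ← ENNReal.ofReal_coe_nnreal, ← ENNReal.ofReal_mul (by positivity)] at hsob
    exact (ENNReal.ofReal_le_ofReal_iff (by positivity)).mp hsob
  -- the derivative of the localized function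
  have hder : ∀ x, ‖fderiv ℝ u x‖ ^ 2 ≤
      2 * (g (x 2) ^ 2 * ‖fderiv ℝ f x‖ ^ 2) + 2 * (deriv g (x 2) ^ 2 * f x ^ 2) := by
    intro x
    have a2 : HasFDerivAt (fun x : EuclideanSpace ℝ (Fin 3) => x 2) (EuclideanSpace.proj (𝕜 := ℝ) 2 : EuclideanSpace ℝ (Fin 3) →L[ℝ] ℝ) x :=
      (EuclideanSpace.proj (𝕜 := ℝ) 2 : EuclideanSpace ℝ (Fin 3) →L[ℝ] ℝ).hasFDerivAt
    have ag : HasDerivAt g (deriv g (x 2)) (x 2) :=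
      (hgc1.differentiable (by simp) _).hasDerivAt
    have af : HasFDerivAt f (fderiv ℝ f x) x := (hf1.differentiable (by simp) x).hasFDerivAt
    have h := ((ag.comp_hasFDerivAt x a2).mul af).fderiv
    have h' : fderiv ℝ u x = _ := h
    have hpr : ‖(EuclideanSpace.proj (𝕜 := ℝ) 2 : EuclideanSpace ℝ (Fin 3) →L[ℝ] ℝ)‖ ≤ 1 := by
      apply ContinuousLinearMap.opNorm_le_bound _ zero_le_one
      intro y
      rw [one_mul]
      exact PiLp.norm_apply_le y 2
    have hn : ‖fderiv ℝ u x‖ ≤ |g (x 2)| * ‖fderiv ℝ f x‖ + |f x| * |deriv g (x 2)| := by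
      rw [h']
      refine (norm_add_le _ _).trans ?_
      rw [norm_smul, norm_smul, norm_smul]
      simp only [Real.norm_eq_abs, Function.comp]
      gcongr
      exact mul_le_of_le_one_right (abs_nonneg _) hpr
    calc ‖fderiv ℝ u x‖ ^ 2
        ≤ (|g (x 2)| * ‖fderiv ℝ f x‖ + |f x| * |deriv g (x 2)|) ^ 2 := by gcongr
      _ ≤ 2 * ((|g (x 2)| * ‖fderiv ℝ f x‖) ^ 2 + (|f x| * |deriv g (x 2)|) ^ 2) := add_sq_le
      _ = _ := by rw [mul_pow, mul_pow, sq_abs, sq_abs, sq_abs]; ring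
  have i1 : Integrable (fun x : EuclideanSpace ℝ (Fin 3) => g (x 2) ^ 2 * ‖fderiv ℝ f x‖ ^ 2) := by
    refine Continuous.integrable_of_hasCompactSupport (by fun_prop) (cpt_supp (2 * Z₀) _ ?_ ?_)
    · intro x hx; simp [hz x hx]
    · intro x hx; simp [hgs _ (habs _ hx)]
  have i2 : Integrable (fun x : EuclideanSpace ℝ (Fin 3) => deriv g (x 2) ^ 2 * f x ^ 2) := by
    refine Continuous.integrable_of_hasCompactSupport (by fun_prop) (cpt_supp (2 * Z₀) _ ?_ ?_)
    · intro x hx; simp [h0 x hx]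
    · intro x hx; simp [hgds _ (habs _ hx)]
  have iu : Integrable (fun x : EuclideanSpace ℝ (Fin 3) => ‖fderiv ℝ u x‖ ^ 2) := by
    refine Continuous.integrable_of_hasCompactSupport (by fun_prop) ?_
    exact hudc.comp_left (g := fun y => ‖y‖ ^ 2) (by simp)
  have i3 : Integrable (fun x : EuclideanSpace ℝ (Fin 3) => ‖u x‖ ^ 3) := by
    have := hu1.continuous
    refine Continuous.integrable_of_hasCompactSupport (by fun_prop) ?_
    exact huc.comp_left (g := fun y => ‖y‖ ^ 3) (by simp)
  have hper' : ∀ x : EuclideanSpace ℝ (Fin 3), ‖fderiv ℝ f (x + Z₀ • EuclideanSpace.single 2 1)‖ ^ 2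
      = ‖fderiv ℝ f x‖ ^ 2 := by
    intro x
    rw [← fderiv_comp_add_right]
    simp only [hper]
  have hH0 : Continuous fun x => ‖fderiv ℝ f x‖ ^ 2 := by fun_prop
  have t1 := three_periods Z₀ hZ₀ (fun x => ‖fderiv ℝ f x‖ ^ 2) hH0 (fun x => by positivity) hper'
    (fun x hx => by simp [hz x hx]) (fun t => g t ^ 2) (by fun_prop) 1
    (fun t => pow_le_one₀ (hg0 t) (hg1 t)) zero_le_one (fun t ht => by simp [hgs t ht])
  have t2 := three_periods Z₀ hZ₀ (fun x => ‖fderiv ℝ f x‖ ^ 2) hH0 (fun x => by positivity) hper'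
    (fun x hx => by simp [hz x hx]) (fun t => deriv g t ^ 2) (by fun_prop) (M ^ 2)
    (fun t => by rw [← sq_abs]; gcongr; exact hgM t) (by positivity)
    (fun t ht => by simp [hgds t ht])
  have hpo := poincare (2 * Z₀) (fun t => deriv g t ^ 2) (hdg1.pow 2) (fun t => by positivity)
    (fun t ht => by simp [hgds t (habs t ht)]) f hf h0
  have hgrad : ∫ x, ‖fderiv ℝ u x‖ ^ 2 ≤ B * ∫ x in D, ‖fderiv ℝ f x‖ ^ 2 := by
    have := integral_mono iu ((i1.const_mul 2).add (i2.const_mul 2)) hder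
    rw [integral_add' (i1.const_mul 2) (i2.const_mul 2), integral_const_mul,
      integral_const_mul] at this
    rw [hB]
    linarith
  have hleft : ∫ x in D, |f x| ^ 3 ≤ ∫ x, ‖u x‖ ^ 3 := by
    calc ∫ x in D, |f x| ^ 3 = ∫ x in D, ‖u x‖ ^ 3 := by
          apply setIntegral_congr_fun hDm
          intro x hx
          simp [u, hgI (x 2) ⟨hx.2.1, hx.2.2.le⟩]
      _ ≤ _ := setIntegral_le_integral i3 (Filter.Eventually.of_forall fun x => by positivity)
  have hI0 : 0 ≤ ∫ x in D, ‖fderiv ℝ f x‖ ^ 2 := integral_nonneg fun x => by positivity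
  calc (∫ x in D, |f x| ^ 3) ^ ((1:ℝ)/3)
      ≤ (∫ x, ‖u x‖ ^ 3) ^ ((1:ℝ)/3) :=
        Real.rpow_le_rpow (integral_nonneg fun x => by positivity) hleft (by norm_num)
    _ ≤ K * (∫ x, ‖fderiv ℝ u x‖ ^ 2) ^ ((1:ℝ)/2) := hsobR
    _ ≤ (K + 1) * (B * ∫ x in D, ‖fderiv ℝ f x‖ ^ 2) ^ ((1:ℝ)/2) := by
        refine mul_le_mul (by linarith) ?_ (by positivity) (by positivity)
        exact Real.rpow_le_rpow (integral_nonneg fun x => by positivity) hgrad (by norm_num)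
    _ = (K + 1) * B ^ ((1:ℝ)/2) * (∫ x in D, ‖fderiv ℝ f x‖ ^ 2) ^ ((1:ℝ)/2) := by
        rw [Real.mul_rpow hBpos.le hI0, mul_assoc]
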